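/- arXiv:2501.01787 — 3 statements merged into one kernel-verified Lean document; each statement's English description precedes it below -/
import Mathlib

section
/- Let N ≥ 1, let h̄₁,…,h̄_N be nonnegative reals, and let K₂, K₄ ≥ 0. Define F : ℝ^N → ℝ by F(x) = (K₂/2) Σ_{n=1}^N h̄_n² x_n² + (3K₄/8) Σ_{(n₀,n₁,n₂,n₃) ∈ S} h̄_{n₀} h̄_{n₁} h̄_{n₂} h̄_{n₃} x_{n₀} x_{n₁} x_{n₂} x_{n₃}. Then F is convex on ℝ^N. -/
open scoped ComplexConjugate in
lemma IsPrimitiveRoot.sum_pow_mul_conj_pow {M : ℕ} {ω : ℂ} (hM : M ≠ 0)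
    (hω : IsPrimitiveRoot ω M) {a b : ℕ} (ha : a < M) (hb : b < M) :
    ∑ k ∈ Finset.range M, (ω ^ k) ^ a * conj ((ω ^ k) ^ b) = if a = b then (M : ℂ) else 0 := by
  have hnorm : ‖ω‖ = 1 := hω.norm'_eq_one hM
  have hconj : ∀ n : ℕ, ω ^ n * conj (ω ^ n) = 1 := fun n => by
    rw [Complex.mul_conj, Complex.normSq_eq_norm_sq, norm_pow, hnorm]
    simp
  have hgeom : ∀ k, (ω ^ k) ^ a * conj ((ω ^ k) ^ b) = (ω ^ a * conj (ω ^ b)) ^ k := fun k => by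
    simp only [map_pow, mul_pow, ← pow_mul, mul_comm]
  simp only [hgeom]
  split_ifs with hab
  · subst hab
    simp [-map_pow, hconj]
  · have hne : ω ^ a * conj (ω ^ b) ≠ 1 := fun h => hab <| hω.pow_inj ha hb <| by
      linear_combination ω ^ b * h - ω ^ a * hconj b
    have hpow : (ω ^ a * conj (ω ^ b)) ^ M = 1 := by
      rw [mul_pow, ← map_pow, ← pow_mul, ← pow_mul, mul_comm a, mul_comm b, pow_mul, pow_mul,
        hω.pow_eq_one]
      simp
    rw [geom_sum_eq hne, hpow, sub_self, zero_div]

open scoped ComplexConjugate in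
lemma Complex.ofReal_norm_sum_pow_four {ι : Type*} [Fintype ι] (w : ι → ℝ) (z : ι → ℂ) :
    ((‖∑ n, (w n : ℂ) * z n‖ ^ 4 : ℝ) : ℂ) =
      ∑ q : ι × ι × ι × ι, ((w q.1 * w q.2.1 * w q.2.2.1 * w q.2.2.2 : ℝ) : ℂ) *
        ((z q.1 * z q.2.1) * conj (z q.2.2.1 * z q.2.2.2)) := by
  have hsq : ∀ y : ℂ, ((‖y‖ ^ 4 : ℝ) : ℂ) = conj y * (conj y * (y * y)) := fun y => by
    have h := Complex.mul_conj' y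
    push_cast
    linear_combination (-(y * conj y) - (‖y‖ : ℂ) ^ 2) * h
  rw [hsq, map_sum]
  simp only [Finset.sum_mul, Finset.mul_sum, Fintype.sum_prod_type]
  refine Finset.sum_congr rfl fun i _ => Finset.sum_congr rfl fun j _ =>
    Finset.sum_congr rfl fun k _ => Finset.sum_congr rfl fun l _ => ?_
  simp only [map_mul, Complex.conj_ofReal]
  push_cast
  ring

/-- Discrete Parseval identity for the square of a trigonometric polynomial. -/
lemma IsPrimitiveRoot.sum_norm_pow_four {N : ℕ} {ω : ℂ} (hN : N ≠ 0)
    (hω : IsPrimitiveRoot ω (2 * N)) (w : Fin N → ℝ) :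
    ∑ k ∈ Finset.range (2 * N), ‖∑ n, (w n : ℂ) * (ω ^ k) ^ (n : ℕ)‖ ^ 4 =
      (2 * N) * ∑ q ∈ Finset.univ.filter
          (fun q : Fin N × Fin N × Fin N × Fin N =>
            (q.1 : ℕ) + (q.2.1 : ℕ) = (q.2.2.1 : ℕ) + (q.2.2.2 : ℕ)),
          w q.1 * w q.2.1 * w q.2.2.1 * w q.2.2.2 := by
  apply Complex.ofReal_injective
  rw [Complex.ofReal_sum]
  simp only [Complex.ofReal_norm_sum_pow_four, ← pow_add]
  rw [Finset.sum_comm, Finset.sum_filter, Complex.ofReal_mul, Complex.ofReal_sum, Finset.mul_sum]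
  refine Finset.sum_congr rfl fun q _ => ?_
  rw [← Finset.mul_sum, hω.sum_pow_mul_conj_pow (by positivity) (by omega) (by omega)]
  split_ifs <;> push_cast <;> ring

lemma convexOn_univ_finset_sum {ι E : Type*} [AddCommMonoid E] [Module ℝ E] (t : Finset ι)
    {f : ι → E → ℝ} (hf : ∀ i ∈ t, ConvexOn ℝ Set.univ (f i)) :
    ConvexOn ℝ Set.univ (fun x => ∑ i ∈ t, f i x) := by
  refine ⟨convex_univ, fun x _ y _ a b ha hb hab => ?_⟩
  simp only [smul_eq_mul, Finset.mul_sum, ← Finset.sum_add_distrib]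
  exact Finset.sum_le_sum fun i hi => (hf i hi).2 trivial trivial ha hb hab

lemma convexOn_norm_sum_pow_four {ι : Type*} [Fintype ι] (c : ι → ℝ) (z : ι → ℂ) :
    ConvexOn ℝ Set.univ (fun x : ι → ℝ => ‖∑ n, ((c n * x n : ℝ) : ℂ) * z n‖ ^ 4) := by
  let L : (ι → ℝ) →ₗ[ℝ] ℂ :=
    { toFun := fun x => ∑ n, ((c n * x n : ℝ) : ℂ) * z n
      map_add' := fun x y => by
        simp [mul_add, add_mul, Finset.sum_add_distrib]
      map_smul' := fun r x => by
        simp only [Pi.smul_apply, smul_eq_mul, RingHom.id_apply, Complex.real_smul,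
          Finset.mul_sum]
        refine Finset.sum_congr rfl fun n _ => ?_
        push_cast
        ring }
  exact (convexOn_univ_norm.comp_linearMap L).pow (fun _ _ => norm_nonneg _) 4

/-- Lemma 1 of the paper: the DC current
`F x = (K₂/2) Σₙ h̄ₙ² xₙ² + (3K₄/8) Σ_{n₀+n₁=n₂+n₃} h̄_{n₀}h̄_{n₁}h̄_{n₂}h̄_{n₃} x_{n₀}x_{n₁}x_{n₂}x_{n₃}`
with nonnegative channel gains `h̄ₙ` and `K₂, K₄ ≥ 0` is convex in the amplitudes `x`. -/
theorem stmt_1 (N : ℕ) (hN : 1 ≤ N) (hbar : Fin N → ℝ) (hpos : ∀ n, 0 ≤ hbar n)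
    (K₂ K₄ : ℝ) (hK₂ : 0 ≤ K₂) (hK₄ : 0 ≤ K₄) :
    ConvexOn ℝ Set.univ (fun x : Fin N → ℝ =>
      K₂ / 2 * ∑ n, hbar n ^ 2 * x n ^ 2 +
      3 * K₄ / 8 * ∑ q ∈ Finset.univ.filter
          (fun q : Fin N × Fin N × Fin N × Fin N =>
            (q.1 : ℕ) + (q.2.1 : ℕ) = (q.2.2.1 : ℕ) + (q.2.2.2 : ℕ)),
          hbar q.1 * hbar q.2.1 * hbar q.2.2.1 * hbar q.2.2.2 *
            (x q.1 * x q.2.1 * x q.2.2.1 * x q.2.2.2)) := by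
  have hN0 : N ≠ 0 := by omega
  have hNR : (N : ℝ) ≠ 0 := by exact_mod_cast hN0
  have hω := Complex.isPrimitiveRoot_exp (2 * N) (by omega)
  set ω := Complex.exp (2 * Real.pi * Complex.I / (2 * N : ℕ))
  have hquad : ConvexOn ℝ Set.univ (fun x : Fin N → ℝ => ∑ n, hbar n ^ 2 * x n ^ 2) :=
    convexOn_univ_finset_sum _ fun n _ => ((even_two.convexOn_pow (𝕜 := ℝ)).comp_linearMap
      (LinearMap.proj (R := ℝ) (φ := fun _ : Fin N => ℝ) n)).smul (sq_nonneg (hbar n))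
  have hquartic : ConvexOn ℝ Set.univ (fun x : Fin N → ℝ => ∑ k ∈ Finset.range (2 * N),
      ‖∑ n, ((hbar n * x n : ℝ) : ℂ) * (ω ^ k) ^ (n : ℕ)‖ ^ 4) :=
    convexOn_univ_finset_sum _ fun k _ => convexOn_norm_sum_pow_four hbar _
  have hc : 0 ≤ 3 * K₄ / 8 / (2 * N) := by positivity
  refine ((hquad.smul (by positivity : (0 : ℝ) ≤ K₂ / 2)).add (hquartic.smul hc)).congr fun x _ => ?_
  simp only [Pi.add_apply, smul_eq_mul]
  rw [hω.sum_norm_pow_four hN0, ← mul_assoc, div_mul_cancel₀ _ (by positivity)]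
  congr 2
  exact Finset.sum_congr rfl fun q _ => by ring
end

section
/- Let N ≥ 1, K₂, K₄ ≥ 0, and for each n ∈ {1,…,N} let s̄_n ≥ 0 be a fixed amplitude and h_n = h̄_n e^{i h̃_n} ∈ ℂ a fixed channel coefficient with modulus h̄_n ≥ 0 and argument h̃_n ∈ ℝ. For a phase vector φ ∈ ℝ^N set c_n(φ) = s̄_n e^{i φ_n} h_n and define i_dc(φ) = (K₂/2) Σ_{n=1}^N h̄_n² s̄_n² + (3K₄/8) Re( Σ_{(n₀,n₁,n₂,n₃) ∈ S} conj(c_{n₀}(φ)) conj(c_{n₁}(φ)) c_{n₂}(φ) c_{n₃}(φ) ). Then the phase vector φ* given by φ*_n = −h̃_n satisfies i_dc(φ) ≤ i_dc(φ*) for every φ ∈ ℝ^N. -/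
/-- The optimal transmit phases compensate the channel phases: with fixed amplitudes
`s̄_n ≥ 0`, channels `h_n = h̄_n e^{i h̃_n}`, weighted coefficients
`c_n(φ) = s̄_n e^{i φ_n} h_n` and DC current
`i_dc(φ) = (K₂/2) Σ h̄_n² s̄_n² + (3K₄/8) Re(Σ_{n₀+n₁=n₂+n₃} conj(c_{n₀}) conj(c_{n₁}) c_{n₂} c_{n₃})`,
the phase vector `φ*_n = −h̃_n` satisfies `i_dc(φ) ≤ i_dc(φ*)` for all `φ`. -/
theorem stmt_7 (N : ℕ) (hN : 1 ≤ N) (K₂ K₄ : ℝ) (hK₂ : 0 ≤ K₂) (hK₄ : 0 ≤ K₄)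
    (sbar hbar htil : Fin N → ℝ) (hs : ∀ n, 0 ≤ sbar n) (hh : ∀ n, 0 ≤ hbar n)
    (h : Fin N → ℂ)
    (hdef : ∀ n, h n = (hbar n : ℂ) * Complex.exp (Complex.I * (htil n : ℂ)))
    (c : (Fin N → ℝ) → Fin N → ℂ)
    (hc : ∀ φ n, c φ n = (sbar n : ℂ) * Complex.exp (Complex.I * (φ n : ℂ)) * h n)
    (idc : (Fin N → ℝ) → ℝ)
    (hidc : ∀ φ, idc φ =
      K₂ / 2 * ∑ n, hbar n ^ 2 * sbar n ^ 2 +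
      3 * K₄ / 8 * (∑ q ∈ Finset.univ.filter
          (fun q : Fin N × Fin N × Fin N × Fin N =>
            (q.1 : ℕ) + (q.2.1 : ℕ) = (q.2.2.1 : ℕ) + (q.2.2.2 : ℕ)),
          (starRingEnd ℂ) (c φ q.1) * (starRingEnd ℂ) (c φ q.2.1) *
            c φ q.2.2.1 * c φ q.2.2.2).re) :
    ∀ φ : Fin N → ℝ, idc φ ≤ idc fun n => -htil n := by
  have norm_c (φ : Fin N → ℝ) (n : Fin N) : ‖c φ n‖ = sbar n * hbar n := by
    rw [hc, hdef]
    simp [Complex.norm_exp, abs_of_nonneg (hs n), abs_of_nonneg (hh n)]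
  have c_opt (n : Fin N) : c (fun n => -htil n) n = ((sbar n * hbar n : ℝ) : ℂ) := by
    rw [hc, hdef, mul_mul_mul_comm, ← Complex.exp_add]
    simp
  intro φ
  rw [hidc, hidc, Complex.re_sum, Complex.re_sum]
  refine add_le_add_right (mul_le_mul_of_nonneg_left ?_ (by positivity)) _
  refine Finset.sum_le_sum fun q _ => (Complex.re_le_norm _).trans (le_of_eq ?_)
  simp only [norm_mul, RCLike.norm_conj, norm_c, c_opt, Complex.conj_ofReal,
    ← Complex.ofReal_mul, Complex.ofReal_re]
end

section
/- Let f_c > 0 and Δf > 0 with f_c/Δf irrational, and set f_n = f_c + (n−1)Δf for n ∈ {1,…,N}. Let c₁,…,c_N ∈ ℂ and define y(t) = Σ_{n=1}^N Re(c_n e^{2π i f_n t}). Then lim_{T→∞} (1/T) ∫₀^T y(t)⁴ dt = (3/8) Σ_{(n₀,n₁,n₂,n₃) ∈ S} conj(c_{n₀}) conj(c_{n₁}) c_{n₂} c_{n₃}, where the right-hand side is a real number. -/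
open Filter

/-- The time average of a pure oscillation `e^{2πiwt}` is `1` if `w = 0` and `0` otherwise. -/
theorem tendsto_average_exp (w : ℝ) :
    Tendsto (fun T : ℝ => ((1 / T : ℝ) : ℂ) *
        ∫ t in (0:ℝ)..T, Complex.exp (2 * Real.pi * Complex.I * (w : ℂ) * (t : ℂ)))
      atTop (nhds (if w = 0 then 1 else 0)) := by
  split_ifs with hw
  · subst hw
    refine tendsto_const_nhds.congr' ?_
    filter_upwards [eventually_ne_atTop 0] with T hT
    have hT' : (T : ℂ) ≠ 0 := by exact_mod_cast hT
    simp [hT']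
  · have hk : (2 * Real.pi * Complex.I * (w : ℂ)) ≠ 0 := by
      simp [hw, Real.pi_ne_zero]
    set k : ℂ := 2 * Real.pi * Complex.I * (w : ℂ) with hkdef
    have hnorm : ∀ T : ℝ, ‖Complex.exp (k * T)‖ = 1 := fun T => by
      have : k * T = ((2 * Real.pi * w * T : ℝ) : ℂ) * Complex.I := by
        rw [hkdef]; push_cast; ring
      rw [this, Complex.norm_exp_ofReal_mul_I]
    have hlim : Tendsto (fun T : ℝ => (1 / T) * (2 / ‖k‖)) atTop (nhds 0) := by
      simpa using tendsto_inv_atTop_zero.mul_const (2 / ‖k‖)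
    refine squeeze_zero_norm' ?_ hlim
    filter_upwards [eventually_gt_atTop 0] with T hT
    rw [integral_exp_mul_complex hk, norm_mul, norm_div, Complex.norm_real,
      Real.norm_of_nonneg (by positivity)]
    gcongr
    calc ‖Complex.exp (k * T) - Complex.exp (k * (0 : ℝ))‖
        ≤ ‖Complex.exp (k * T)‖ + ‖Complex.exp (k * (0 : ℝ))‖ := norm_sub_le _ _
      _ = 2 := by rw [hnorm, hnorm]; norm_num

/-- The time average of a trigonometric polynomial is the sum of its coefficients of
frequency zero. -/
theorem tendsto_average_sum_exp {ι : Type*} [Fintype ι] (a : ι → ℂ) (w : ι → ℝ) :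
    Tendsto (fun T : ℝ => ((1 / T : ℝ) : ℂ) *
        ∫ t in (0:ℝ)..T, ∑ i, a i * Complex.exp (2 * Real.pi * Complex.I * (w i : ℂ) * (t : ℂ)))
      atTop (nhds (∑ i with w i = 0, a i)) := by
  have key := tendsto_finsetSum Finset.univ
    (fun i _ => (tendsto_average_exp (w i)).const_mul (a i))
  have hlim : ∑ i, a i * (if w i = 0 then 1 else 0) = ∑ i with w i = 0, a i := by
    simp [Finset.sum_filter]
  rw [← hlim]
  refine key.congr fun T => ?_
  rw [intervalIntegral.integral_finsetSum
    fun i _ => Continuous.intervalIntegrable (by fun_prop) _ _, Finset.mul_sum]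
  refine Finset.sum_congr rfl fun i _ => ?_
  rw [intervalIntegral.integral_const_mul]
  ring

/-- A product of four finite sums as a sum over quadruples. -/
theorem sum_mul_sum_mul_sum_mul_sum {ι R : Type*} [Fintype ι] [CommSemiring R]
    (a b c d : ι → R) :
    (∑ i, a i) * (∑ i, b i) * (∑ i, c i) * (∑ i, d i) =
      ∑ q : ι × ι × ι × ι, a q.1 * b q.2.1 * c q.2.2.1 * d q.2.2.2 := by
  simp only [Fintype.sum_prod_type, mul_assoc, ← Finset.mul_sum, ← Finset.sum_mul]

/-- The time average of a product of four trigonometric polynomials. -/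
theorem tendsto_average_mul_four {ι : Type*} [Fintype ι] (a₀ a₁ a₂ a₃ : ι → ℂ)
    (w₀ w₁ w₂ w₃ : ι → ℝ) :
    Tendsto (fun T : ℝ => ((1 / T : ℝ) : ℂ) * ∫ t in (0:ℝ)..T,
        (∑ i, a₀ i * Complex.exp (2 * Real.pi * Complex.I * (w₀ i : ℂ) * (t : ℂ))) *
        (∑ i, a₁ i * Complex.exp (2 * Real.pi * Complex.I * (w₁ i : ℂ) * (t : ℂ))) *
        (∑ i, a₂ i * Complex.exp (2 * Real.pi * Complex.I * (w₂ i : ℂ) * (t : ℂ))) *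
        (∑ i, a₃ i * Complex.exp (2 * Real.pi * Complex.I * (w₃ i : ℂ) * (t : ℂ))))
      atTop (nhds (∑ q : ι × ι × ι × ι with
        w₀ q.1 + w₁ q.2.1 + w₂ q.2.2.1 + w₃ q.2.2.2 = 0,
        a₀ q.1 * a₁ q.2.1 * a₂ q.2.2.1 * a₃ q.2.2.2)) := by
  refine (tendsto_average_sum_exp
    (fun q : ι × ι × ι × ι => a₀ q.1 * a₁ q.2.1 * a₂ q.2.2.1 * a₃ q.2.2.2)
    (fun q => w₀ q.1 + w₁ q.2.1 + w₂ q.2.2.1 + w₃ q.2.2.2)).congr fun T => ?_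
  congr 1
  refine intervalIntegral.integral_congr fun t _ => ?_
  simp only [sum_mul_sum_mul_sum_mul_sum]
  refine Finset.sum_congr rfl fun q _ => ?_
  push_cast
  simp only [mul_add, add_mul, Complex.exp_add]
  ring

/-- The fourth power of a real part, expanded by frequency content. -/
theorem re_pow_four (z : ℂ) :
    z.re ^ 4 = (3 / 8 * (star z * star z * z * z) + 1 / 8 * (z * z * z * z) +
      1 / 2 * (z * z * z * star z)).re := by
  have h : ((z.re ^ 4 : ℝ) : ℂ) + ((z.re ^ 4 : ℝ) : ℂ) =
      (3 / 8 * (star z * star z * z * z) + 1 / 8 * (z * z * z * z) +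
        1 / 2 * (z * z * z * star z)) +
      star (3 / 8 * (star z * star z * z * z) + 1 / 8 * (z * z * z * z) +
        1 / 2 * (z * z * z * star z)) := by
    push_cast
    rw [Complex.re_eq_add_conj]
    simp
    ring
  have h' := congrArg Complex.re h
  rw [Complex.add_re, Complex.add_re _ (star _), Complex.star_def, Complex.conj_re,
    Complex.ofReal_re] at h'
  rw [Complex.star_def]
  linarith

/-- The conjugate of a trigonometric polynomial. -/
theorem conj_sum_mul_exp {ι : Type*} [Fintype ι] (c : ι → ℂ) (f : ι → ℝ) (t : ℝ) :
    star (∑ n, c n * Complex.exp (2 * Real.pi * Complex.I * (f n : ℂ) * (t : ℂ))) =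
      ∑ n, (starRingEnd ℂ) (c n) *
        Complex.exp (2 * Real.pi * Complex.I * ((-f n : ℝ) : ℂ) * (t : ℂ)) := by
  simp [← Complex.exp_conj, Complex.conj_ofNat]

/-- A nonzero integer multiple of `x` plus an integer multiple of `y` does not vanish when
`x / y` is irrational. -/
theorem int_mul_add_int_mul_ne_zero {x y : ℝ} (h : Irrational (x / y)) (hy : y ≠ 0)
    {k : ℤ} (hk : k ≠ 0) (m : ℤ) : k * x + m * y ≠ 0 := by
  intro h0
  apply h
  refine ⟨-m / k, ?_⟩
  have hk' : (k : ℝ) ≠ 0 := by exact_mod_cast hk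
  push_cast
  rw [div_eq_div_iff hk' hy]
  linarith

/-- Fourth-order time average of the multi-carrier signal (equation (3) of the paper):
with `f_n = f_c + (n−1)Δf`, `f_c/Δf` irrational, and `y(t) = Σₙ Re(cₙ e^{2πi fₙ t})`,
`lim_{T→∞} (1/T) ∫₀ᵀ y(t)⁴ dt = (3/8) Σ_{n₀+n₁=n₂+n₃} conj(c_{n₀}) conj(c_{n₁}) c_{n₂} c_{n₃}`,
the right-hand side being a real number. -/
theorem stmt_13 (N : ℕ) (fc Δf : ℝ) (hfc : 0 < fc) (hΔf : 0 < Δf)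
    (hirr : Irrational (fc / Δf)) (f : Fin N → ℝ)
    (hf : ∀ n : Fin N, f n = fc + (n : ℕ) * Δf) (c : Fin N → ℂ) :
    (∑ q ∈ Finset.univ.filter
        (fun q : Fin N × Fin N × Fin N × Fin N =>
          (q.1 : ℕ) + (q.2.1 : ℕ) = (q.2.2.1 : ℕ) + (q.2.2.2 : ℕ)),
        (starRingEnd ℂ) (c q.1) * (starRingEnd ℂ) (c q.2.1) * c q.2.2.1 * c q.2.2.2).im
      = 0 ∧
    Tendsto (fun T : ℝ => (1 / T) *
        ∫ t in (0:ℝ)..T,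
          (∑ n, (c n * Complex.exp (2 * Real.pi * Complex.I * (f n : ℂ) * (t : ℂ))).re) ^ 4)
      atTop
      (nhds ((3 / 8) * (∑ q ∈ Finset.univ.filter
          (fun q : Fin N × Fin N × Fin N × Fin N =>
            (q.1 : ℕ) + (q.2.1 : ℕ) = (q.2.2.1 : ℕ) + (q.2.2.2 : ℕ)),
          (starRingEnd ℂ) (c q.1) * (starRingEnd ℂ) (c q.2.1) *
            c q.2.2.1 * c q.2.2.2).re)) := by
  have hΔ := hΔf.ne'
  constructor
  · rw [← Complex.conj_eq_iff_im, map_sum]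
    refine Finset.sum_nbij' (fun q => (q.2.2.1, q.2.2.2, q.1, q.2.1))
      (fun q => (q.2.2.1, q.2.2.2, q.1, q.2.1)) ?_ ?_ ?_ ?_ ?_
    · simp +contextual
    · simp +contextual
    · simp
    · simp
    · intro q _
      simp only [map_mul, Complex.conj_conj]
      ring
  let z : ℝ → ℂ := fun t =>
    ∑ n, c n * Complex.exp (2 * Real.pi * Complex.I * (f n : ℂ) * (t : ℂ))
  have h₁ := tendsto_average_mul_four (fun n => (starRingEnd ℂ) (c n))
    (fun n => (starRingEnd ℂ) (c n)) c c (fun n => -f n) (fun n => -f n) f f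
  have h₂ := tendsto_average_mul_four c c c c f f f f
  have h₃ := tendsto_average_mul_four c c c (fun n => (starRingEnd ℂ) (c n)) f f f (fun n => -f n)
  simp only [← conj_sum_mul_exp] at h₁ h₃
  rw [Finset.filter_congr (q := fun q : Fin N × Fin N × Fin N × Fin N =>
      (q.1 : ℕ) + (q.2.1 : ℕ) = (q.2.2.1 : ℕ) + (q.2.2.2 : ℕ)) fun q _ => ?_] at h₁
  swap
  · simp only [hf]
    rw [← Nat.cast_inj (R := ℝ), ← mul_left_inj' (a := ((_ + _ : ℕ) : ℝ)) hΔ]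
    push_cast
    constructor <;> intro h <;> linarith
  rw [Finset.filter_false_of_mem fun q _ => ?_, Finset.sum_empty] at h₂
  swap
  · have hpos : ∀ n, 0 < f n := fun n => by rw [hf]; positivity
    have := hpos q.1
    have := hpos q.2.1
    have := hpos q.2.2.1
    have := hpos q.2.2.2
    positivity
  rw [Finset.filter_false_of_mem fun q _ => ?_, Finset.sum_empty] at h₃
  swap
  · have h := int_mul_add_int_mul_ne_zero hirr hΔ two_ne_zero
      ((q.1 : ℕ) + (q.2.1 : ℕ) + (q.2.2.1 : ℕ) - (q.2.2.2 : ℕ) : ℤ)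
    contrapose! h
    simp only [hf] at h
    push_cast
    linarith
  have key := (((h₁.const_mul (3 / 8)).add (h₂.const_mul (1 / 8))).add
    (h₃.const_mul (1 / 2)))
  have hre := (Complex.continuous_re.tendsto _).comp key
  have hlim : ∀ s : ℂ, (3 / 8 * s + 1 / 8 * 0 + 1 / 2 * 0).re = 3 / 8 * s.re := fun s => by
    have : (3 / 8 * s + 1 / 8 * 0 + 1 / 2 * 0 : ℂ) = ((3 / 8 : ℝ) : ℂ) * s := by
      push_cast; ring
    rw [this, Complex.re_ofReal_mul]
  rw [hlim] at hre
  refine hre.congr fun T => ?_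
  have hint : ∀ g : ℝ → ℂ, Continuous g → IntervalIntegrable g MeasureTheory.volume 0 T :=
    fun g hg => hg.intervalIntegrable _ _
  have hcomm := Complex.reCLM.intervalIntegral_comp_comm (hint (fun t =>
    3 / 8 * (star (z t) * star (z t) * z t * z t) + 1 / 8 * (z t * z t * z t * z t) +
      1 / 2 * (z t * z t * z t * star (z t))) (by fun_prop))
  simp only [← Complex.re_sum, re_pow_four]
  simp only [Complex.reCLM_apply] at hcomm
  refine Eq.trans ?_ (congrArg (1 / T * ·) hcomm).symm
  rw [intervalIntegral.integral_add (hint _ (by fun_prop)) (hint _ (by fun_prop)),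
    intervalIntegral.integral_add (hint _ (by fun_prop)) (hint _ (by fun_prop))]
  simp only [intervalIntegral.integral_const_mul, Function.comp_apply]
  rw [← Complex.re_ofReal_mul]
  congr 1
  ring
end
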